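/- arXiv:1009.1547 — 3 statements merged into one kernel-verified Lean document; each statement's English description precedes it below -/
import Mathlib

section
/- In the abstract BGG chain-level setting, let σ ∈ H0 be a solution of the first BGG equation, i.e. Θ₀ σ = 0. Then σ is normal (that is, nabla(L₀ σ) = 0) if and only if ∂₂(d(nabla(L₀ σ))) = 0. (In the geometric picture, d ∘ nabla is the curvature action s ↦ K • s, so the condition reads ∂*(K • L₀σ) = 0.) -/
/-- Abstract BGG chain-level data: spaces `C0, C1, C2` of tractor-bundle-valued
0-, 1-, 2-forms, the tractor covariant derivative `nabla`, the exterior covariant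
derivative `d`, and the Kostant codifferentials `del1, del2` with `del1 ∘ del2 = 0`. -/
structure BGGData (C0 C1 C2 : Type*) [AddCommGroup C0] [Module ℝ C0]
    [AddCommGroup C1] [Module ℝ C1] [AddCommGroup C2] [Module ℝ C2] where
  nabla : C0 →ₗ[ℝ] C1
  d : C1 →ₗ[ℝ] C2
  del1 : C1 →ₗ[ℝ] C0
  del2 : C2 →ₗ[ℝ] C1
  del_comp : del1 ∘ₗ del2 = 0

namespace BGGData

variable {C0 C1 C2 : Type*} [AddCommGroup C0] [Module ℝ C0]
  [AddCommGroup C1] [Module ℝ C1] [AddCommGroup C2] [Module ℝ C2]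
  (D : BGGData C0 C1 C2)

/-- The cycles `Z1 = ker ∂₁`. -/
abbrev Z1 : Submodule ℝ C1 := LinearMap.ker D.del1

/-- The homology `H0 = C0 ⧸ range ∂₁`. -/
abbrev H0 : Type _ := C0 ⧸ LinearMap.range D.del1

/-- The canonical projection `Π₀ : C0 → H0`. -/
def pi0 : C0 →ₗ[ℝ] D.H0 := (LinearMap.range D.del1).mkQ

/-- `∂₂` corestricted to `Z1` (possible since `∂₁ ∘ ∂₂ = 0`). -/
def del2' : C2 →ₗ[ℝ] D.Z1 :=
  D.del2.codRestrict D.Z1 (fun x => LinearMap.mem_ker.mpr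
    (by simpa using LinearMap.ext_iff.mp D.del_comp x))

/-- The homology `H1 = Z1 ⧸ range ∂₂`. -/
abbrev H1 : Type _ := D.Z1 ⧸ LinearMap.range D.del2'

/-- The canonical projection `Π₁ : Z1 → H1`. -/
def pi1 : D.Z1 →ₗ[ℝ] D.H1 := (LinearMap.range D.del2').mkQ

end BGGData

/-- Splitting operators `L₀ : H0 → C0` and `L₁ : H1 → Z1` with their
characterizing properties. -/
structure BGGSplitting {C0 C1 C2 : Type*} [AddCommGroup C0] [Module ℝ C0]
    [AddCommGroup C1] [Module ℝ C1] [AddCommGroup C2] [Module ℝ C2]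
    (D : BGGData C0 C1 C2) where
  L0 : D.H0 →ₗ[ℝ] C0
  pi0_L0 : ∀ σ, D.pi0 (L0 σ) = σ
  L0_char : ∀ s : C0, D.del1 (D.nabla s) = 0 ↔ s = L0 (D.pi0 s)
  L1 : D.H1 →ₗ[ℝ] D.Z1
  pi1_L1 : ∀ τ, D.pi1 (L1 τ) = τ
  L1_char : ∀ s₁ : D.Z1, D.del2 (D.d s₁.1) = 0 → s₁ = L1 (D.pi1 s₁)

/-- The first BGG operator `Θ₀ = Π₁ ∘ ∇ ∘ L₀`; note that `∇(L₀ σ) ∈ Z1` by the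
characterizing property of `L₀`. -/
def BGGSplitting.Theta0 {C0 C1 C2 : Type*} [AddCommGroup C0] [Module ℝ C0]
    [AddCommGroup C1] [Module ℝ C1] [AddCommGroup C2] [Module ℝ C2]
    {D : BGGData C0 C1 C2} (S : BGGSplitting D) (σ : D.H0) : D.H1 :=
  D.pi1 ⟨D.nabla (S.L0 σ), LinearMap.mem_ker.mpr
    ((S.L0_char (S.L0 σ)).mpr (by rw [S.pi0_L0]))⟩

/-- A solution `σ` of the first BGG equation `Θ₀ σ = 0` is normal
(`∇(L₀ σ) = 0`) if and only if `∂₂(d(∇(L₀ σ))) = 0` (geometrically: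
`∂*(K • L₀σ) = 0`). -/
theorem normal_solution_iff_del2_curvature_vanishes
    {C0 C1 C2 : Type*} [AddCommGroup C0] [Module ℝ C0]
    [AddCommGroup C1] [Module ℝ C1] [AddCommGroup C2] [Module ℝ C2]
    (D : BGGData C0 C1 C2) (S : BGGSplitting D) (σ : D.H0)
    (hσ : S.Theta0 σ = 0) :
    D.nabla (S.L0 σ) = 0 ↔ D.del2 (D.d (D.nabla (S.L0 σ))) = 0 := by
  constructor
  · intro h
    rw [h, map_zero, map_zero]
  · intro h
    have h1 := S.L1_char ⟨D.nabla (S.L0 σ), LinearMap.mem_ker.mpr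
      ((S.L0_char (S.L0 σ)).mpr (by rw [S.pi0_L0]))⟩ h
    unfold BGGSplitting.Theta0 at hσ
    rw [hσ, map_zero] at h1
    exact congrArg Subtype.val h1
end

section
/- In the abstract BGG chain-level setting, if the curvature action vanishes, i.e. d ∘ nabla = 0 (the flat case), then every solution σ ∈ H0 of Θ₀ σ = 0 is normal, i.e. nabla(L₀ σ) = 0. -/
/-- In the flat case (`d ∘ ∇ = 0`, vanishing curvature action) every solution
`σ` of `Θ₀ σ = 0` is normal: `∇(L₀ σ) = 0`. -/
theorem flat_implies_all_solutions_normal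
    {C0 C1 C2 : Type*} [AddCommGroup C0] [Module ℝ C0]
    [AddCommGroup C1] [Module ℝ C1] [AddCommGroup C2] [Module ℝ C2]
    (D : BGGData C0 C1 C2) (S : BGGSplitting D)
    (hflat : D.d ∘ₗ D.nabla = 0) (σ : D.H0)
    (hσ : S.Theta0 σ = 0) :
    D.nabla (S.L0 σ) = 0 := by
  have hf : D.d (D.nabla (S.L0 σ)) = 0 := LinearMap.ext_iff.mp hflat (S.L0 σ)
  have h := S.L1_char ⟨D.nabla (S.L0 σ), LinearMap.mem_ker.mpr
    ((S.L0_char (S.L0 σ)).mpr (by rw [S.pi0_L0]))⟩ (by rw [hf, map_zero])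
  unfold BGGSplitting.Theta0 at hσ
  rw [hσ, map_zero] at h
  exact congrArg Subtype.val h
end

section
/- In the abstract BGG coupling setting, if σ ∈ H0^V and σ' ∈ H0^{V'} are normal solutions of the first BGG equations Θ₀^V σ = 0 and Θ₀^{V'} σ' = 0 (i.e. nabla^V(L₀^V σ) = 0 and nabla^{V'}(L₀^{V'} σ') = 0), then the coupled section η := Π₀^W(C⁰(L₀^V σ, L₀^{V'} σ')) ∈ H0^W is a normal solution of Θ₀^W: one has Θ₀^W η = 0 and nabla^W(L₀^W η) = 0, with L₀^W η = C⁰(L₀^V σ, L₀^{V'} σ'). -/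
section Coupling

variable {CV0 CV1 CV2 CV'0 CV'1 CV'2 CW0 CW1 CW2 : Type*}
  [AddCommGroup CV0] [Module ℝ CV0] [AddCommGroup CV1] [Module ℝ CV1]
  [AddCommGroup CV2] [Module ℝ CV2]
  [AddCommGroup CV'0] [Module ℝ CV'0] [AddCommGroup CV'1] [Module ℝ CV'1]
  [AddCommGroup CV'2] [Module ℝ CV'2]
  [AddCommGroup CW0] [Module ℝ CW0] [AddCommGroup CW1] [Module ℝ CW1]
  [AddCommGroup CW2] [Module ℝ CW2]

/-- Coupling of normal solutions: if `σ` and `σ'` are normal solutions of the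
first BGG equations for `V` and `V'`, and `C⁰` is a coupling map satisfying the
Leibniz rule with respect to the tractor connections, then
`η := Π₀^W(C⁰(L₀^V σ, L₀^{V'} σ'))` is a normal solution of `Θ₀^W`, with
`L₀^W η = C⁰(L₀^V σ, L₀^{V'} σ')`. -/
theorem coupling_of_normal_solutions_is_normal
    (DV : BGGData CV0 CV1 CV2) (SV : BGGSplitting DV)
    (DV' : BGGData CV'0 CV'1 CV'2) (SV' : BGGSplitting DV')
    (DW : BGGData CW0 CW1 CW2) (SW : BGGSplitting DW)
    (Cb0 : CV0 →ₗ[ℝ] CV'0 →ₗ[ℝ] CW0)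
    (Cb1 : CV1 →ₗ[ℝ] CV'0 →ₗ[ℝ] CW1)
    (Cb1' : CV0 →ₗ[ℝ] CV'1 →ₗ[ℝ] CW1)
    (leibniz : ∀ (s : CV0) (s' : CV'0),
      DW.nabla (Cb0 s s') = Cb1 (DV.nabla s) s' + Cb1' s (DV'.nabla s'))
    (σ : DV.H0) (σ' : DV'.H0)
    (hσ : SV.Theta0 σ = 0) (hσnorm : DV.nabla (SV.L0 σ) = 0)
    (hσ' : SV'.Theta0 σ' = 0) (hσ'norm : DV'.nabla (SV'.L0 σ') = 0) :
    SW.Theta0 (DW.pi0 (Cb0 (SV.L0 σ) (SV'.L0 σ'))) = 0 ∧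
    DW.nabla (SW.L0 (DW.pi0 (Cb0 (SV.L0 σ) (SV'.L0 σ')))) = 0 ∧
    SW.L0 (DW.pi0 (Cb0 (SV.L0 σ) (SV'.L0 σ'))) = Cb0 (SV.L0 σ) (SV'.L0 σ') := by
  have h0 : DW.nabla (Cb0 (SV.L0 σ) (SV'.L0 σ')) = 0 := by
    rw [leibniz, hσnorm, hσ'norm]
    simp
  have hL : SW.L0 (DW.pi0 (Cb0 (SV.L0 σ) (SV'.L0 σ'))) = Cb0 (SV.L0 σ) (SV'.L0 σ') :=
    ((SW.L0_char _).mp (by rw [h0, map_zero])).symm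
  have hN : DW.nabla (SW.L0 (DW.pi0 (Cb0 (SV.L0 σ) (SV'.L0 σ')))) = 0 := by
    rw [hL, h0]
  refine ⟨?_, hN, hL⟩
  unfold BGGSplitting.Theta0
  refine Eq.trans (congrArg DW.pi1 (Subtype.ext ?_)) (map_zero DW.pi1)
  exact hN

end Coupling
end
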